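/- arXiv:1801.01838 — 6 statements merged into one kernel-verified Lean document; each statement's English description precedes it below -/
import Mathlib

section
/- Let δ, Δ > 0 and let Ã be a real symmetric positive definite Nu×Nu matrix such that δ · v^T Ã v ≤ v^T A v ≤ Δ · v^T Ã v for all v ∈ ℝ^{Nu}. Then, under the standing assumptions, for every nonzero w ∈ ℝ^{Q·Nu} one has (ν̲₀ − √3·σ·χ)·δ · w^T (I_Q ⊗ Ã) w ≤ w^T 𝒜 w ≤ (ν̄₀ + √3·σ·χ)·Δ · w^T (I_Q ⊗ Ã) w. (Eigenvalue bounds for the multigrid-preconditioned stochastic Galerkin finite element Laplacian.) -/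
open Matrix
open scoped Kronecker BigOperators

lemma psd_of_quad {n : Type*} [Fintype n] (B : Matrix n n ℝ) (hB : B.IsSymm)
    (h : ∀ v : n → ℝ, 0 ≤ v ⬝ᵥ B *ᵥ v) : B.PosSemidef := by
  refine Matrix.PosSemidef.of_dotProduct_mulVec_nonneg ?_ ?_
  · rw [Matrix.IsHermitian, Matrix.conjTranspose_eq_transpose_of_trivial]; exact hB
  · intro v; simpa using h v

lemma kron_nonneg {m n : Type*} [Fintype m] [Fintype n] [DecidableEq m] [DecidableEq n]
    (G : Matrix m m ℝ) (B : Matrix n n ℝ)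
    (hG : G.IsSymm) (hB : B.IsSymm)
    (hG' : ∀ v : m → ℝ, 0 ≤ v ⬝ᵥ G *ᵥ v) (hB' : ∀ v : n → ℝ, 0 ≤ v ⬝ᵥ B *ᵥ v)
    (w : m × n → ℝ) : 0 ≤ w ⬝ᵥ (G ⊗ₖ B) *ᵥ w := by
  simpa using ((psd_of_quad G hG hG').kronecker (psd_of_quad B hB hB')).dotProduct_mulVec_nonneg w

lemma one_kron_le {m n : Type*} [Fintype m] [Fintype n] [DecidableEq m] [DecidableEq n]
    (B C : Matrix n n ℝ) (hB : B.IsSymm) (hC : C.IsSymm) (c d : ℝ)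
    (h : ∀ v : n → ℝ, c * (v ⬝ᵥ B *ᵥ v) ≤ d * (v ⬝ᵥ C *ᵥ v))
    (w : m × n → ℝ) :
    c * (w ⬝ᵥ ((1 : Matrix m m ℝ) ⊗ₖ B) *ᵥ w) ≤ d * (w ⬝ᵥ ((1 : Matrix m m ℝ) ⊗ₖ C) *ᵥ w) := by
  have := kron_nonneg (1 : Matrix m m ℝ) (d • C + (-c) • B) (Matrix.isSymm_one)
    ((hC.smul d).add (hB.smul (-c)))
    (fun v => by rw [one_mulVec]; exact Finset.sum_nonneg fun i _ => mul_self_nonneg _)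
    (fun v => by
      have := h v
      simp only [add_mulVec, smul_mulVec, dotProduct_add, dotProduct_smul, smul_eq_mul]
      linarith) w
  simp only [kronecker_add, kronecker_smul, add_mulVec, smul_mulVec, dotProduct_add,
    dotProduct_smul, smul_eq_mul] at this
  linarith

lemma kron_le {m n : Type*} [Fintype m] [Fintype n] [DecidableEq m] [DecidableEq n]
    (G : Matrix m m ℝ) (A B : Matrix n n ℝ) (hG : G.IsSymm) (hA : A.IsSymm) (hB : B.IsSymm)
    (s c : ℝ)
    (hG' : ∀ v : m → ℝ, |v ⬝ᵥ G *ᵥ v| ≤ s * (v ⬝ᵥ v))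
    (hB' : ∀ v : n → ℝ, |v ⬝ᵥ B *ᵥ v| ≤ c * (v ⬝ᵥ A *ᵥ v))
    (w : m × n → ℝ) :
    |w ⬝ᵥ (G ⊗ₖ B) *ᵥ w| ≤ s * c * (w ⬝ᵥ ((1 : Matrix m m ℝ) ⊗ₖ A) *ᵥ w) := by
  have key : ∀ e f : ℝ, (e = 1 ∨ e = -1) → (f = 1 ∨ f = -1) →
      0 ≤ w ⬝ᵥ ((s • (1 : Matrix m m ℝ) + e • G) ⊗ₖ (c • A + f • B)) *ᵥ w := by
    intro e f he hf
    refine kron_nonneg _ _ ((Matrix.isSymm_one.smul s).add (hG.smul e))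
      ((hA.smul c).add (hB.smul f)) (fun v => ?_) (fun v => ?_) w
    · have := abs_le.1 (hG' v)
      simp only [add_mulVec, smul_mulVec, dotProduct_add, dotProduct_smul, smul_eq_mul, one_mulVec]
      rcases he with rfl | rfl <;> linarith
    · have := abs_le.1 (hB' v)
      simp only [add_mulVec, smul_mulVec, dotProduct_add, dotProduct_smul, smul_eq_mul]
      rcases hf with rfl | rfl <;> linarith
  have h1 := key 1 1 (by simp) (by simp)
  have h2 := key 1 (-1) (by simp) (by simp)
  have h3 := key (-1) 1 (by simp) (by simp)
  have h4 := key (-1) (-1) (by simp) (by simp)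
  simp only [kronecker_add, add_kronecker, smul_kronecker, kronecker_smul, add_mulVec, smul_mulVec,
    dotProduct_add, dotProduct_smul, smul_eq_mul] at h1 h2 h3 h4
  rw [abs_le]
  constructor <;> linarith

/-- Eigenvalue bounds for the multigrid-preconditioned stochastic Galerkin
finite element Laplacian (Lemma on `Ã_mg⁻¹ 𝒜`). -/
theorem stmt_0
    (Q Nu M : ℕ) (hQ : 0 < Q) (hNu : 0 < Nu)
    (A A0 : Matrix (Fin Nu) (Fin Nu) ℝ)
    (Am : Fin M → Matrix (Fin Nu) (Fin Nu) ℝ)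
    (G : Fin M → Matrix (Fin Q) (Fin Q) ℝ)
    (hAsymm : A.IsSymm) (hA0symm : A0.IsSymm)
    (hAmsymm : ∀ m, (Am m).IsSymm) (hGsymm : ∀ m, (G m).IsSymm)
    (𝒜 : Matrix (Fin Q × Fin Nu) (Fin Q × Fin Nu) ℝ)
    (h𝒜 : 𝒜 = (1 : Matrix (Fin Q) (Fin Q) ℝ) ⊗ₖ A0 + ∑ m, (G m) ⊗ₖ (Am m))
    (hApd : ∀ v : Fin Nu → ℝ, v ≠ 0 → 0 < v ⬝ᵥ A *ᵥ v)
    (σ : ℝ) (hσ : 0 ≤ σ)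
    (χm : Fin M → ℝ) (hχm : ∀ m, 0 ≤ χm m)
    (χ : ℝ) (hχ : χ = ∑ m, χm m)
    (νlo νhi : ℝ) (hνlo : 0 < νlo) (hνlohi : νlo ≤ νhi)
    (hA0lo : ∀ v : Fin Nu → ℝ, νlo * (v ⬝ᵥ A *ᵥ v) ≤ v ⬝ᵥ A0 *ᵥ v)
    (hA0hi : ∀ v : Fin Nu → ℝ, v ⬝ᵥ A0 *ᵥ v ≤ νhi * (v ⬝ᵥ A *ᵥ v))
    (hAmb : ∀ m, ∀ v : Fin Nu → ℝ, |v ⬝ᵥ (Am m) *ᵥ v| ≤ σ * χm m * (v ⬝ᵥ A *ᵥ v))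
    (hGb : ∀ m, ∀ a : Fin Q → ℝ, |a ⬝ᵥ (G m) *ᵥ a| ≤ Real.sqrt 3 * (a ⬝ᵥ a))
    (hKL : Real.sqrt 3 * σ * χ < νlo)
    (δ Δ : ℝ) (hδ : 0 < δ) (hΔ : 0 < Δ)
    (Atil : Matrix (Fin Nu) (Fin Nu) ℝ) (hAtilsymm : Atil.IsSymm)
    (hAtilpd : ∀ v : Fin Nu → ℝ, v ≠ 0 → 0 < v ⬝ᵥ Atil *ᵥ v)
    (hlo : ∀ v : Fin Nu → ℝ, δ * (v ⬝ᵥ Atil *ᵥ v) ≤ v ⬝ᵥ A *ᵥ v)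
    (hhi : ∀ v : Fin Nu → ℝ, v ⬝ᵥ A *ᵥ v ≤ Δ * (v ⬝ᵥ Atil *ᵥ v)) :
    ∀ w : Fin Q × Fin Nu → ℝ, w ≠ 0 →
      (νlo - Real.sqrt 3 * σ * χ) * δ *
          (w ⬝ᵥ ((1 : Matrix (Fin Q) (Fin Q) ℝ) ⊗ₖ Atil) *ᵥ w) ≤ w ⬝ᵥ 𝒜 *ᵥ w ∧
      w ⬝ᵥ 𝒜 *ᵥ w ≤ (νhi + Real.sqrt 3 * σ * χ) * Δ *
          (w ⬝ᵥ ((1 : Matrix (Fin Q) (Fin Q) ℝ) ⊗ₖ Atil) *ᵥ w) := by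
  intro w _
  have hlow := one_kron_le (m := Fin Q) A A0 hAsymm hA0symm νlo 1 (by simpa using hA0lo) w
  have hupp := one_kron_le (m := Fin Q) A0 A hA0symm hAsymm 1 νhi (by simpa using hA0hi) w
  have htl := one_kron_le (m := Fin Q) Atil A hAtilsymm hAsymm δ 1 (by simpa using hlo) w
  have htu := one_kron_le (m := Fin Q) A Atil hAsymm hAtilsymm 1 Δ (by simpa using hhi) w
  have hm := fun m => kron_le (G m) A (Am m) (hGsymm m) hAsymm (hAmsymm m) _ _ (hGb m) (hAmb m) w
  have hsum : |∑ m, w ⬝ᵥ ((G m) ⊗ₖ (Am m)) *ᵥ w| ≤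
      Real.sqrt 3 * σ * χ * (w ⬝ᵥ ((1 : Matrix (Fin Q) (Fin Q) ℝ) ⊗ₖ A) *ᵥ w) := by
    refine (Finset.abs_sum_le_sum_abs _ _).trans ((Finset.sum_le_sum fun m _ => hm m).trans ?_)
    rw [hχ, Finset.mul_sum, Finset.sum_mul]
    exact le_of_eq (Finset.sum_congr rfl fun m _ => by ring)
  have hE : w ⬝ᵥ 𝒜 *ᵥ w = w ⬝ᵥ ((1 : Matrix (Fin Q) (Fin Q) ℝ) ⊗ₖ A0) *ᵥ w
      + ∑ m, w ⬝ᵥ ((G m) ⊗ₖ (Am m)) *ᵥ w := by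
    rw [h𝒜, add_mulVec, dotProduct_add, sum_mulVec, dotProduct_sum]
  have hχ0 : 0 ≤ Real.sqrt 3 * σ * χ := by
    have : 0 ≤ χ := hχ ▸ Finset.sum_nonneg fun m _ => hχm m
    positivity
  rw [hE]
  obtain ⟨ha, hb⟩ := abs_le.1 hsum
  have k1 := mul_le_mul_of_nonneg_left htl (sub_nonneg.2 hKL.le)
  have k2 := mul_le_mul_of_nonneg_left htu (a := νhi + Real.sqrt 3 * σ * χ) (by linarith)
  constructor <;> linarith
end

section
/- Let G be a real symmetric Q×Q matrix with |a^T G a| ≤ g · a^T a for all a ∈ ℝ^Q, where g ≥ 0; let Y be a real symmetric positive definite Nu×Nu matrix and X a real symmetric Nu×Nu matrix with |v^T X v| ≤ c · v^T Y v for all v ∈ ℝ^{Nu}, where c ≥ 0. Then |w^T (G ⊗ X) w| ≤ g·c · w^T (I_Q ⊗ Y) w for all w ∈ ℝ^{Q·Nu}. -/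
open Matrix
open scoped Kronecker

/-- Quadratic-form bound for a Kronecker product `G ⊗ X` in terms of `I_Q ⊗ Y`. -/
theorem stmt_1
    (Q Nu : ℕ) (hQ : 0 < Q) (hNu : 0 < Nu)
    (G : Matrix (Fin Q) (Fin Q) ℝ) (hGsymm : G.IsSymm)
    (g : ℝ) (hg : 0 ≤ g)
    (hGb : ∀ a : Fin Q → ℝ, |a ⬝ᵥ G *ᵥ a| ≤ g * (a ⬝ᵥ a))
    (Y : Matrix (Fin Nu) (Fin Nu) ℝ) (hYsymm : Y.IsSymm)
    (hYpd : ∀ v : Fin Nu → ℝ, v ≠ 0 → 0 < v ⬝ᵥ Y *ᵥ v)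
    (X : Matrix (Fin Nu) (Fin Nu) ℝ) (hXsymm : X.IsSymm)
    (c : ℝ) (hc : 0 ≤ c)
    (hXb : ∀ v : Fin Nu → ℝ, |v ⬝ᵥ X *ᵥ v| ≤ c * (v ⬝ᵥ Y *ᵥ v)) :
    ∀ w : Fin Q × Fin Nu → ℝ,
      |w ⬝ᵥ (G ⊗ₖ X) *ᵥ w| ≤
        g * c * (w ⬝ᵥ ((1 : Matrix (Fin Q) (Fin Q) ℝ) ⊗ₖ Y) *ᵥ w) := by
  intro w
  have key : ∀ (A : Matrix (Fin Q) (Fin Q) ℝ) (B : Matrix (Fin Nu) (Fin Nu) ℝ),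
      A.IsSymm → B.IsSymm → (∀ a, 0 ≤ a ⬝ᵥ A *ᵥ a) → (∀ v, 0 ≤ v ⬝ᵥ B *ᵥ v) →
      0 ≤ w ⬝ᵥ (A ⊗ₖ B) *ᵥ w := by
    intro A B hA hB hA' hB'
    have pA : A.PosSemidef := Matrix.PosSemidef.of_dotProduct_mulVec_nonneg
      (by simpa [Matrix.IsHermitian, Matrix.conjTranspose_eq_transpose_of_trivial] using hA.eq)
      (by simpa using hA')
    have pB : B.PosSemidef := Matrix.PosSemidef.of_dotProduct_mulVec_nonneg
      (by simpa [Matrix.IsHermitian, Matrix.conjTranspose_eq_transpose_of_trivial] using hB.eq)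
      (by simpa using hB')
    simpa using (pA.kronecker pB).dotProduct_mulVec_nonneg w
  have s1 : (g • (1 : Matrix (Fin Q) (Fin Q) ℝ)).IsSymm := by simp [Matrix.IsSymm]
  have s2 : (c • Y).IsSymm := hYsymm.smul c
  have a1 := key (g • 1 - G) (c • Y + X) (s1.sub hGsymm) (s2.add hXsymm)
    (fun a => by
      have := abs_le.1 (hGb a)
      simp [sub_mulVec, smul_mulVec]; linarith)
    (fun a => by
      have := abs_le.1 (hXb a)
      simp [add_mulVec, smul_mulVec]; linarith)
  have a2 := key (g • 1 + G) (c • Y - X) (s1.add hGsymm) (s2.sub hXsymm)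
    (fun a => by
      have := abs_le.1 (hGb a)
      simp [add_mulVec, smul_mulVec]; linarith)
    (fun a => by
      have := abs_le.1 (hXb a)
      simp [sub_mulVec, smul_mulVec]; linarith)
  have a3 := key (g • 1 - G) (c • Y - X) (s1.sub hGsymm) (s2.sub hXsymm)
    (fun a => by
      have := abs_le.1 (hGb a)
      simp [sub_mulVec, smul_mulVec]; linarith)
    (fun a => by
      have := abs_le.1 (hXb a)
      simp [sub_mulVec, smul_mulVec]; linarith)
  have a4 := key (g • 1 + G) (c • Y + X) (s1.add hGsymm) (s2.add hXsymm)
    (fun a => by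
      have := abs_le.1 (hGb a)
      simp [add_mulVec, smul_mulVec]; linarith)
    (fun a => by
      have := abs_le.1 (hXb a)
      simp [add_mulVec, smul_mulVec]; linarith)
  have e1 : (g • (1 : Matrix (Fin Q) (Fin Q) ℝ) - G) ⊗ₖ (c • Y + X)
      + (g • 1 + G) ⊗ₖ (c • Y - X)
      = (2 * (g * c)) • ((1 : Matrix (Fin Q) (Fin Q) ℝ) ⊗ₖ Y) - (2 : ℝ) • (G ⊗ₖ X) := by
    ext ⟨i, j⟩ ⟨k, l⟩
    simp only [Matrix.add_apply, Matrix.sub_apply, Matrix.smul_apply, kronecker_apply, smul_eq_mul]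
    ring
  have e2 : (g • (1 : Matrix (Fin Q) (Fin Q) ℝ) - G) ⊗ₖ (c • Y - X)
      + (g • 1 + G) ⊗ₖ (c • Y + X)
      = (2 * (g * c)) • ((1 : Matrix (Fin Q) (Fin Q) ℝ) ⊗ₖ Y) + (2 : ℝ) • (G ⊗ₖ X) := by
    ext ⟨i, j⟩ ⟨k, l⟩
    simp only [Matrix.add_apply, Matrix.sub_apply, Matrix.smul_apply, kronecker_apply, smul_eq_mul]
    ring
  have f1 := congrArg (fun M => w ⬝ᵥ M *ᵥ w) e1
  have f2 := congrArg (fun M => w ⬝ᵥ M *ᵥ w) e2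
  simp only [add_mulVec _ _ w, sub_mulVec _ _ w, smul_mulVec _ _ w, dotProduct_add, dotProduct_sub,
    dotProduct_smul, smul_eq_mul] at f1 f2
  rw [abs_le]
  constructor <;> linarith
end

section
/- Under the standing assumptions, (ν̲₀ − √3·σ·χ) · w^T (I_Q ⊗ A) w ≤ w^T 𝒜 w ≤ (ν̄₀ + √3·σ·χ) · w^T (I_Q ⊗ A) w for all w ∈ ℝ^{Q·Nu}; in particular, the stochastic Galerkin finite element Laplacian 𝒜 is symmetric positive definite. -/
open Matrix
open scoped Kronecker BigOperators

lemma psd_of {n : Type*} [Fintype n] {X : Matrix n n ℝ} (hs : X.IsSymm)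
    (h : ∀ v : n → ℝ, 0 ≤ v ⬝ᵥ X *ᵥ v) : X.PosSemidef := by
  refine Matrix.PosSemidef.of_dotProduct_mulVec_nonneg ?_ (fun v => by simpa using h v)
  simpa [Matrix.IsHermitian, Matrix.conjTranspose_eq_transpose_of_trivial] using hs.eq

lemma kron_nonneg_s2 {p n : Type*} [Fintype p] [Fintype n] [DecidableEq p] [DecidableEq n]
    {X : Matrix p p ℝ} {Y : Matrix n n ℝ} (hX : X.PosSemidef) (hY : Y.PosSemidef)
    (w : p × n → ℝ) : 0 ≤ w ⬝ᵥ (X ⊗ₖ Y) *ᵥ w := by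
  simpa using (hX.kronecker hY).dotProduct_mulVec_nonneg w

lemma kron_bound {p n : Type*} [Fintype p] [Fintype n] [DecidableEq p] [DecidableEq n]
    {G : Matrix p p ℝ} {A B : Matrix n n ℝ} (hG : G.IsSymm) (hA : A.IsSymm) (hB : B.IsSymm)
    (s c : ℝ) (h1 : ∀ v : n → ℝ, |v ⬝ᵥ B *ᵥ v| ≤ c * (v ⬝ᵥ A *ᵥ v))
    (h2 : ∀ a : p → ℝ, |a ⬝ᵥ G *ᵥ a| ≤ s * (a ⬝ᵥ a)) (w : p × n → ℝ) :
    |w ⬝ᵥ (G ⊗ₖ B) *ᵥ w| ≤ s * c * (w ⬝ᵥ ((1 : Matrix p p ℝ) ⊗ₖ A) *ᵥ w) := by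
  have hGp : (s • (1 : Matrix p p ℝ) + G).PosSemidef := psd_of
    ((Matrix.isSymm_one.smul s).add hG) (fun v => by
      have := (abs_le.1 (h2 v)).1
      simp only [add_mulVec, smul_mulVec, one_mulVec, dotProduct_add, dotProduct_smul, smul_eq_mul]
      linarith)
  have hGm : (s • (1 : Matrix p p ℝ) - G).PosSemidef := psd_of
    ((Matrix.isSymm_one.smul s).sub hG) (fun v => by
      have := (abs_le.1 (h2 v)).2
      simp only [sub_mulVec, smul_mulVec, one_mulVec, dotProduct_sub, dotProduct_smul, smul_eq_mul]
      linarith)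
  have hBp : (c • A + B).PosSemidef := psd_of ((hA.smul c).add hB) (fun v => by
      have := (abs_le.1 (h1 v)).1
      simp only [add_mulVec, smul_mulVec, dotProduct_add, dotProduct_smul, smul_eq_mul]
      linarith)
  have hBm : (c • A - B).PosSemidef := psd_of ((hA.smul c).sub hB) (fun v => by
      have := (abs_le.1 (h1 v)).2
      simp only [sub_mulVec, smul_mulVec, dotProduct_sub, dotProduct_smul, smul_eq_mul]
      linarith)
  have e1 : (s • (1 : Matrix p p ℝ) + G) ⊗ₖ (c • A - B) + (s • (1 : Matrix p p ℝ) - G) ⊗ₖ (c • A + B)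
      = (2 * s * c) • ((1 : Matrix p p ℝ) ⊗ₖ A) - (2 : ℝ) • (G ⊗ₖ B) := by
    ext i j
    simp [Matrix.kroneckerMap_apply]
    ring
  have e2 : (s • (1 : Matrix p p ℝ) + G) ⊗ₖ (c • A + B) + (s • (1 : Matrix p p ℝ) - G) ⊗ₖ (c • A - B)
      = (2 * s * c) • ((1 : Matrix p p ℝ) ⊗ₖ A) + (2 : ℝ) • (G ⊗ₖ B) := by
    ext i j
    simp [Matrix.kroneckerMap_apply]
    ring
  have f1 := congrArg (fun X => w ⬝ᵥ X *ᵥ w) e1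
  have f2 := congrArg (fun X => w ⬝ᵥ X *ᵥ w) e2
  simp only [sub_mulVec, smul_mulVec, dotProduct_sub, dotProduct_smul, smul_eq_mul,
    add_mulVec, dotProduct_add] at f1 f2
  have a1 := kron_nonneg_s2 hGp hBm w
  have a2 := kron_nonneg_s2 hGm hBp w
  have a3 := kron_nonneg_s2 hGp hBp w
  have a4 := kron_nonneg_s2 hGm hBm w
  rw [abs_le]
  constructor <;> linarith

/-- Spectral bounds of the SGFE Laplacian `𝒜` with respect to the mean-based
matrix `I_Q ⊗ A`; in particular `𝒜` is symmetric positive definite. -/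
theorem stmt_2
    (Q Nu M : ℕ) (hQ : 0 < Q) (hNu : 0 < Nu)
    (A A0 : Matrix (Fin Nu) (Fin Nu) ℝ)
    (Am : Fin M → Matrix (Fin Nu) (Fin Nu) ℝ)
    (G : Fin M → Matrix (Fin Q) (Fin Q) ℝ)
    (hAsymm : A.IsSymm) (hA0symm : A0.IsSymm)
    (hAmsymm : ∀ m, (Am m).IsSymm) (hGsymm : ∀ m, (G m).IsSymm)
    (𝒜 : Matrix (Fin Q × Fin Nu) (Fin Q × Fin Nu) ℝ)
    (h𝒜 : 𝒜 = (1 : Matrix (Fin Q) (Fin Q) ℝ) ⊗ₖ A0 + ∑ m, (G m) ⊗ₖ (Am m))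
    (hApd : ∀ v : Fin Nu → ℝ, v ≠ 0 → 0 < v ⬝ᵥ A *ᵥ v)
    (σ : ℝ) (hσ : 0 ≤ σ)
    (χm : Fin M → ℝ) (hχm : ∀ m, 0 ≤ χm m)
    (χ : ℝ) (hχ : χ = ∑ m, χm m)
    (νlo νhi : ℝ) (hνlo : 0 < νlo) (hνlohi : νlo ≤ νhi)
    (hA0lo : ∀ v : Fin Nu → ℝ, νlo * (v ⬝ᵥ A *ᵥ v) ≤ v ⬝ᵥ A0 *ᵥ v)
    (hA0hi : ∀ v : Fin Nu → ℝ, v ⬝ᵥ A0 *ᵥ v ≤ νhi * (v ⬝ᵥ A *ᵥ v))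
    (hAmb : ∀ m, ∀ v : Fin Nu → ℝ, |v ⬝ᵥ (Am m) *ᵥ v| ≤ σ * χm m * (v ⬝ᵥ A *ᵥ v))
    (hGb : ∀ m, ∀ a : Fin Q → ℝ, |a ⬝ᵥ (G m) *ᵥ a| ≤ Real.sqrt 3 * (a ⬝ᵥ a))
    (hKL : Real.sqrt 3 * σ * χ < νlo) :
    (∀ w : Fin Q × Fin Nu → ℝ,
      (νlo - Real.sqrt 3 * σ * χ) *
          (w ⬝ᵥ ((1 : Matrix (Fin Q) (Fin Q) ℝ) ⊗ₖ A) *ᵥ w) ≤ w ⬝ᵥ 𝒜 *ᵥ w ∧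
      w ⬝ᵥ 𝒜 *ᵥ w ≤ (νhi + Real.sqrt 3 * σ * χ) *
          (w ⬝ᵥ ((1 : Matrix (Fin Q) (Fin Q) ℝ) ⊗ₖ A) *ᵥ w)) ∧
    𝒜.IsSymm ∧ (∀ w : Fin Q × Fin Nu → ℝ, w ≠ 0 → 0 < w ⬝ᵥ 𝒜 *ᵥ w) := by
  have hsymm : 𝒜.IsSymm := by
    rw [h𝒜, Matrix.IsSymm, transpose_add, transpose_sum, ← kroneckerMap_transpose,
      transpose_one, hA0symm.eq]
    congr 1
    refine Finset.sum_congr rfl fun m _ => ?_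
    rw [← kroneckerMap_transpose, (hGsymm m).eq, (hAmsymm m).eq]
  have hb : ∀ w : Fin Q × Fin Nu → ℝ,
      (νlo - Real.sqrt 3 * σ * χ) *
          (w ⬝ᵥ ((1 : Matrix (Fin Q) (Fin Q) ℝ) ⊗ₖ A) *ᵥ w) ≤ w ⬝ᵥ 𝒜 *ᵥ w ∧
      w ⬝ᵥ 𝒜 *ᵥ w ≤ (νhi + Real.sqrt 3 * σ * χ) *
          (w ⬝ᵥ ((1 : Matrix (Fin Q) (Fin Q) ℝ) ⊗ₖ A) *ᵥ w) := by
    intro w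
    have hlo : (A0 - νlo • A).PosSemidef := psd_of (hA0symm.sub (hAsymm.smul _)) (fun v => by
      have := hA0lo v
      simp only [sub_mulVec, smul_mulVec, dotProduct_sub, dotProduct_smul, smul_eq_mul]
      linarith)
    have hhi : (νhi • A - A0).PosSemidef := psd_of ((hAsymm.smul _).sub hA0symm) (fun v => by
      have := hA0hi v
      simp only [sub_mulVec, smul_mulVec, dotProduct_sub, dotProduct_smul, smul_eq_mul]
      linarith)
    have k1 := kron_nonneg_s2 (Matrix.PosSemidef.one (n := Fin Q) (R := ℝ)) hlo w
    have k2 := kron_nonneg_s2 (Matrix.PosSemidef.one (n := Fin Q) (R := ℝ)) hhi w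
    have e1 : (1 : Matrix (Fin Q) (Fin Q) ℝ) ⊗ₖ (A0 - νlo • A) =
        (1 : Matrix (Fin Q) (Fin Q) ℝ) ⊗ₖ A0 - νlo • ((1 : Matrix (Fin Q) (Fin Q) ℝ) ⊗ₖ A) := by
      ext i j
      simp [Matrix.kroneckerMap_apply]
      ring
    have e2 : (1 : Matrix (Fin Q) (Fin Q) ℝ) ⊗ₖ (νhi • A - A0) =
        νhi • ((1 : Matrix (Fin Q) (Fin Q) ℝ) ⊗ₖ A) - (1 : Matrix (Fin Q) (Fin Q) ℝ) ⊗ₖ A0 := by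
      ext i j
      simp [Matrix.kroneckerMap_apply]
      ring
    rw [e1] at k1
    rw [e2] at k2
    simp only [sub_mulVec, smul_mulVec, dotProduct_sub, dotProduct_smul, smul_eq_mul] at k1 k2
    have hsum : |∑ m, w ⬝ᵥ ((G m) ⊗ₖ (Am m)) *ᵥ w| ≤ Real.sqrt 3 * σ * χ *
        (w ⬝ᵥ ((1 : Matrix (Fin Q) (Fin Q) ℝ) ⊗ₖ A) *ᵥ w) := by
      refine (Finset.abs_sum_le_sum_abs _ _).trans ?_
      rw [hχ, Finset.mul_sum, Finset.sum_mul]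
      refine Finset.sum_le_sum fun m _ => ?_
      have := kron_bound (hGsymm m) hAsymm (hAmsymm m) (Real.sqrt 3) (σ * χm m) (hAmb m) (hGb m) w
      rwa [← mul_assoc] at this
    have hE : w ⬝ᵥ 𝒜 *ᵥ w = w ⬝ᵥ ((1 : Matrix (Fin Q) (Fin Q) ℝ) ⊗ₖ A0) *ᵥ w +
        ∑ m, w ⬝ᵥ ((G m) ⊗ₖ (Am m)) *ᵥ w := by
      rw [h𝒜, add_mulVec, dotProduct_add, Matrix.sum_mulVec, dotProduct_sum]
    have := abs_le.1 hsum
    rw [hE]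
    constructor <;> linarith [this.1, this.2]
  refine ⟨hb, hsymm, fun w hw => ?_⟩
  have hApd' : A.PosDef := by
    refine Matrix.PosDef.of_dotProduct_mulVec_pos ?_ (fun v hv => by simpa using hApd v hv)
    simpa [Matrix.IsHermitian, Matrix.conjTranspose_eq_transpose_of_trivial] using hAsymm.eq
  have hp : 0 < w ⬝ᵥ ((1 : Matrix (Fin Q) (Fin Q) ℝ) ⊗ₖ A) *ᵥ w := by
    simpa using ((Matrix.PosDef.one (n := Fin Q) (R := ℝ)).kronecker hApd').dotProduct_mulVec_pos hw
  exact lt_of_lt_of_le (mul_pos (sub_pos.2 hKL) hp) (hb w).1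
end

section
/- In addition to the standing assumptions, let B be a real Np×Nu matrix, let D_p be a real symmetric positive definite Np×Np matrix, and let θ, γ, Θ > 0 satisfy θ²·γ² · q^T D_p q ≤ q^T B A^{-1} B^T q ≤ Θ² · q^T D_p q for all q ∈ ℝ^{Np}. Then for all p ∈ ℝ^{Q·Np}, (θ²·γ²)/(ν̄₀ + √3·σ·χ) · p^T (I_Q ⊗ D_p) p ≤ p^T (I_Q ⊗ B) 𝒜^{-1} (I_Q ⊗ B)^T p ≤ Θ²/(ν̲₀ − √3·σ·χ) · p^T (I_Q ⊗ D_p) p. (Eigenvalue bounds for the preconditioned stochastic Galerkin finite element Schur complement.) -/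
open Matrix
open scoped Kronecker BigOperators

lemma aux_inv_mono {n : Type*} [Fintype n] [DecidableEq n] (X Y : Matrix n n ℝ) (c : ℝ)
    (hc : 0 < c) (hXs : X.IsSymm) (hXp : ∀ v, 0 ≤ v ⬝ᵥ X *ᵥ v)
    (hXu : IsUnit X.det) (hYu : IsUnit Y.det)
    (h : ∀ v, c * (v ⬝ᵥ X *ᵥ v) ≤ v ⬝ᵥ Y *ᵥ v) (x : n → ℝ) :
    c * (x ⬝ᵥ Y⁻¹ *ᵥ x) ≤ x ⬝ᵥ X⁻¹ *ᵥ x := by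
  obtain ⟨y, hy⟩ : ∃ y, y = Y⁻¹ *ᵥ x := ⟨_, rfl⟩
  obtain ⟨z, hz⟩ : ∃ z, z = X⁻¹ *ᵥ x := ⟨_, rfl⟩
  have hYy : Y *ᵥ y = x := by
    rw [hy, mulVec_mulVec, Matrix.mul_nonsing_inv _ hYu, one_mulVec]
  have hXz : X *ᵥ z = x := by
    rw [hz, mulVec_mulVec, Matrix.mul_nonsing_inv _ hXu, one_mulVec]
  rw [← hy, ← hz]
  have h1 := hXp (c • y - z)
  have h2 := h y
  have h3 : z ⬝ᵥ X *ᵥ y = x ⬝ᵥ y := by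
    rw [dotProduct_mulVec, ← mulVec_transpose, hXs.eq, hXz]
  rw [hYy] at h2
  rw [mulVec_sub, mulVec_smul, hXz, sub_dotProduct, dotProduct_sub, dotProduct_sub,
    smul_dotProduct, smul_dotProduct, dotProduct_smul, dotProduct_smul, h3,
    dotProduct_comm z x] at h1
  rw [dotProduct_comm y x] at h1 h2
  simp only [smul_eq_mul] at h1
  have h4 := mul_le_mul_of_nonneg_left h2 hc.le
  linarith

lemma aux_unit {n : Type*} [Fintype n] [DecidableEq n] (X : Matrix n n ℝ)
    (hp : ∀ v, v ≠ 0 → 0 < v ⬝ᵥ X *ᵥ v) : IsUnit X.det := by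
  rw [isUnit_iff_ne_zero]
  intro h0
  obtain ⟨v, hv, h⟩ := Matrix.exists_mulVec_eq_zero_iff.mpr h0
  have := hp v hv
  rw [h] at this
  simp at this

lemma aux_one_kron {Q N : ℕ} (S : Matrix (Fin N) (Fin N) ℝ) (p : Fin Q × Fin N → ℝ) :
    p ⬝ᵥ ((1 : Matrix (Fin Q) (Fin Q) ℝ) ⊗ₖ S) *ᵥ p =
      ∑ i, (fun j => p (i, j)) ⬝ᵥ S *ᵥ (fun j => p (i, j)) := by
  simp [dotProduct, mulVec, Fintype.sum_prod_type, Matrix.one_apply, ite_mul,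
    Finset.sum_ite_eq, ← Finset.mul_sum]

lemma aux_psd {n : Type*} [Fintype n] (X : Matrix n n ℝ) (hs : X.IsSymm)
    (hp : ∀ v, 0 ≤ v ⬝ᵥ X *ᵥ v) : X.PosSemidef := by
  refine Matrix.PosSemidef.of_dotProduct_mulVec_nonneg ?_ ?_
  · rw [Matrix.IsHermitian, conjTranspose_eq_transpose_of_trivial]; exact hs
  · intro v; simpa using hp v

lemma aux_kron_nonneg {Q N : ℕ} (X : Matrix (Fin Q) (Fin Q) ℝ) (Y : Matrix (Fin N) (Fin N) ℝ)
    (hX : X.IsSymm) (hY : Y.IsSymm)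
    (hXp : ∀ v, 0 ≤ v ⬝ᵥ X *ᵥ v) (hYp : ∀ v, 0 ≤ v ⬝ᵥ Y *ᵥ v) (v : Fin Q × Fin N → ℝ) :
    0 ≤ v ⬝ᵥ (X ⊗ₖ Y) *ᵥ v := by
  have := ((aux_psd X hX hXp).kronecker (aux_psd Y hY hYp)).dotProduct_mulVec_nonneg v
  simpa using this

lemma aux_kron_le {Q N : ℕ} (G : Matrix (Fin Q) (Fin Q) ℝ) (A H : Matrix (Fin N) (Fin N) ℝ)
    (hG : G.IsSymm) (hA : A.IsSymm) (hH : H.IsSymm) (s c : ℝ)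
    (hGb : ∀ a, |a ⬝ᵥ G *ᵥ a| ≤ s * (a ⬝ᵥ a))
    (hHb : ∀ a, |a ⬝ᵥ H *ᵥ a| ≤ c * (a ⬝ᵥ A *ᵥ a)) (v : Fin Q × Fin N → ℝ) :
    v ⬝ᵥ (G ⊗ₖ H) *ᵥ v ≤ s * c * (v ⬝ᵥ ((1 : Matrix (Fin Q) (Fin Q) ℝ) ⊗ₖ A) *ᵥ v) := by
  have h1 := aux_kron_nonneg (s • 1 + G) (c • A - H) ((Matrix.isSymm_one.smul s).add hG)
    ((hA.smul c).sub hH)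
    (fun a => by
      have := abs_le.mp (hGb a)
      simp only [add_mulVec, smul_mulVec, one_mulVec, dotProduct_add, dotProduct_smul, smul_eq_mul]
      linarith)
    (fun a => by
      have := abs_le.mp (hHb a)
      simp only [sub_mulVec, smul_mulVec, dotProduct_sub, dotProduct_smul, smul_eq_mul]
      linarith) v
  have h2 := aux_kron_nonneg (s • 1 - G) (c • A + H) ((Matrix.isSymm_one.smul s).sub hG)
    ((hA.smul c).add hH)
    (fun a => by
      have := abs_le.mp (hGb a)
      simp only [sub_mulVec, smul_mulVec, one_mulVec, dotProduct_sub, dotProduct_smul, smul_eq_mul]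
      linarith)
    (fun a => by
      have := abs_le.mp (hHb a)
      simp only [add_mulVec, smul_mulVec, dotProduct_add, dotProduct_smul, smul_eq_mul]
      linarith) v
  have h3 : (s • 1 + G) ⊗ₖ (c • A - H) + (s • 1 - G) ⊗ₖ (c • A + H)
      = (2 * (s * c)) • ((1 : Matrix (Fin Q) (Fin Q) ℝ) ⊗ₖ A) - (2 : ℝ) • (G ⊗ₖ H) := by
    ext i j
    simp only [Matrix.add_apply, Matrix.sub_apply, Matrix.smul_apply, kroneckerMap_apply,
      smul_eq_mul]
    ring
  have h4 := add_nonneg h1 h2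
  rw [← dotProduct_add, ← add_mulVec, h3] at h4
  simp only [sub_mulVec, smul_mulVec, dotProduct_sub, dotProduct_smul, smul_eq_mul] at h4
  linarith

/-- Eigenvalue bounds for the preconditioned SGFE Schur complement. -/
theorem stmt_4
    (Q Nu Np M : ℕ) (hQ : 0 < Q) (hNu : 0 < Nu) (hNp : 0 < Np)
    (A A0 : Matrix (Fin Nu) (Fin Nu) ℝ)
    (Am : Fin M → Matrix (Fin Nu) (Fin Nu) ℝ)
    (G : Fin M → Matrix (Fin Q) (Fin Q) ℝ)
    (hAsymm : A.IsSymm) (hA0symm : A0.IsSymm)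
    (hAmsymm : ∀ m, (Am m).IsSymm) (hGsymm : ∀ m, (G m).IsSymm)
    (𝒜 : Matrix (Fin Q × Fin Nu) (Fin Q × Fin Nu) ℝ)
    (h𝒜 : 𝒜 = (1 : Matrix (Fin Q) (Fin Q) ℝ) ⊗ₖ A0 + ∑ m, (G m) ⊗ₖ (Am m))
    (hApd : ∀ v : Fin Nu → ℝ, v ≠ 0 → 0 < v ⬝ᵥ A *ᵥ v)
    (σ : ℝ) (hσ : 0 ≤ σ)
    (χm : Fin M → ℝ) (hχm : ∀ m, 0 ≤ χm m)
    (χ : ℝ) (hχ : χ = ∑ m, χm m)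
    (νlo νhi : ℝ) (hνlo : 0 < νlo) (hνlohi : νlo ≤ νhi)
    (hA0lo : ∀ v : Fin Nu → ℝ, νlo * (v ⬝ᵥ A *ᵥ v) ≤ v ⬝ᵥ A0 *ᵥ v)
    (hA0hi : ∀ v : Fin Nu → ℝ, v ⬝ᵥ A0 *ᵥ v ≤ νhi * (v ⬝ᵥ A *ᵥ v))
    (hAmb : ∀ m, ∀ v : Fin Nu → ℝ, |v ⬝ᵥ (Am m) *ᵥ v| ≤ σ * χm m * (v ⬝ᵥ A *ᵥ v))
    (hGb : ∀ m, ∀ a : Fin Q → ℝ, |a ⬝ᵥ (G m) *ᵥ a| ≤ Real.sqrt 3 * (a ⬝ᵥ a))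
    (hKL : Real.sqrt 3 * σ * χ < νlo)
    (B : Matrix (Fin Np) (Fin Nu) ℝ)
    (Dp : Matrix (Fin Np) (Fin Np) ℝ) (hDpsymm : Dp.IsSymm)
    (hDppd : ∀ q : Fin Np → ℝ, q ≠ 0 → 0 < q ⬝ᵥ Dp *ᵥ q)
    (θ γ Θ : ℝ) (hθ : 0 < θ) (hγ : 0 < γ) (hΘ : 0 < Θ)
    (hSlo : ∀ q : Fin Np → ℝ,
      θ ^ 2 * γ ^ 2 * (q ⬝ᵥ Dp *ᵥ q) ≤ q ⬝ᵥ (B * A⁻¹ * Bᵀ) *ᵥ q)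
    (hShi : ∀ q : Fin Np → ℝ,
      q ⬝ᵥ (B * A⁻¹ * Bᵀ) *ᵥ q ≤ Θ ^ 2 * (q ⬝ᵥ Dp *ᵥ q)) :
    ∀ p : Fin Q × Fin Np → ℝ,
      θ ^ 2 * γ ^ 2 / (νhi + Real.sqrt 3 * σ * χ) *
          (p ⬝ᵥ ((1 : Matrix (Fin Q) (Fin Q) ℝ) ⊗ₖ Dp) *ᵥ p) ≤
        p ⬝ᵥ (((1 : Matrix (Fin Q) (Fin Q) ℝ) ⊗ₖ B) * 𝒜⁻¹ *
            ((1 : Matrix (Fin Q) (Fin Q) ℝ) ⊗ₖ B)ᵀ) *ᵥ p ∧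
      p ⬝ᵥ (((1 : Matrix (Fin Q) (Fin Q) ℝ) ⊗ₖ B) * 𝒜⁻¹ *
            ((1 : Matrix (Fin Q) (Fin Q) ℝ) ⊗ₖ B)ᵀ) *ᵥ p ≤
        Θ ^ 2 / (νlo - Real.sqrt 3 * σ * χ) *
          (p ⬝ᵥ ((1 : Matrix (Fin Q) (Fin Q) ℝ) ⊗ₖ Dp) *ᵥ p) := by
  intro p
  obtain ⟨K, hK⟩ : ∃ K, K = (1 : Matrix (Fin Q) (Fin Q) ℝ) ⊗ₖ A := ⟨_, rfl⟩
  have hKs : K.IsSymm := by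
    rw [hK, Matrix.IsSymm, ← kroneckerMap_transpose, hAsymm.eq, transpose_one]
  have hA0' : ∀ v : Fin Nu → ℝ, 0 ≤ v ⬝ᵥ A *ᵥ v := by
    intro v
    by_cases hv : v = 0
    · simp [hv]
    · exact (hApd v hv).le
  have hKp : ∀ v, v ≠ 0 → 0 < v ⬝ᵥ K *ᵥ v := by
    intro v hv
    rw [hK, aux_one_kron]
    obtain ⟨⟨i, j⟩, hij⟩ := Function.ne_iff.mp hv
    refine Finset.sum_pos' (fun i _ => hA0' _) ⟨i, Finset.mem_univ _, hApd _ ?_⟩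
    exact fun h => hij (congrFun h j)
  have hKp' : ∀ v, 0 ≤ v ⬝ᵥ K *ᵥ v := by
    intro v
    by_cases hv : v = 0
    · simp [hv]
    · exact (hKp v hv).le
  have h𝒜s : 𝒜.IsSymm := by
    rw [h𝒜, Matrix.IsSymm, transpose_add, transpose_sum, ← kroneckerMap_transpose, hA0symm.eq,
      transpose_one]
    congr 1
    refine Finset.sum_congr rfl fun m _ => ?_
    rw [← kroneckerMap_transpose, (hGsymm m).eq, (hAmsymm m).eq]
  have hexp : ∀ v, v ⬝ᵥ 𝒜 *ᵥ v = v ⬝ᵥ ((1 : Matrix (Fin Q) (Fin Q) ℝ) ⊗ₖ A0) *ᵥ v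
      + ∑ m, v ⬝ᵥ (G m ⊗ₖ Am m) *ᵥ v := by
    intro v
    rw [h𝒜, add_mulVec, dotProduct_add, sum_mulVec, dotProduct_sum]
  have hsum : ∀ v, ∑ m, (√3 * (σ * χm m) * (v ⬝ᵥ K *ᵥ v)) = √3 * σ * χ * (v ⬝ᵥ K *ᵥ v) := by
    intro v
    rw [← Finset.sum_mul, ← Finset.mul_sum, ← Finset.mul_sum, ← hχ]
    ring
  have hub : ∀ v, ∑ m, v ⬝ᵥ (G m ⊗ₖ Am m) *ᵥ v ≤ √3 * σ * χ * (v ⬝ᵥ K *ᵥ v) := by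
    intro v
    rw [← hsum v, hK]
    exact Finset.sum_le_sum fun m _ => aux_kron_le (G m) A (Am m) (hGsymm m) hAsymm (hAmsymm m)
      _ _ (hGb m) (hAmb m) v
  have hlb : ∀ v, -(√3 * σ * χ * (v ⬝ᵥ K *ᵥ v)) ≤ ∑ m, v ⬝ᵥ (G m ⊗ₖ Am m) *ᵥ v := by
    intro v
    rw [neg_le, ← hsum v, hK, ← Finset.sum_neg_distrib]
    refine Finset.sum_le_sum fun m _ => ?_
    have := aux_kron_le (-G m) A (Am m) (hGsymm m).neg hAsymm (hAmsymm m)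
      (√3) (σ * χm m) (fun a => by
        rw [neg_mulVec, dotProduct_neg, abs_neg]; exact hGb m a) (hAmb m) v
    have e : (-G m) ⊗ₖ Am m = -(G m ⊗ₖ Am m) := by
      ext i j; simp [kroneckerMap_apply]
    rwa [e, neg_mulVec, dotProduct_neg] at this
  have h0lo : ∀ v, νlo * (v ⬝ᵥ K *ᵥ v) ≤ v ⬝ᵥ ((1 : Matrix (Fin Q) (Fin Q) ℝ) ⊗ₖ A0) *ᵥ v := by
    intro v
    rw [hK, aux_one_kron, aux_one_kron, Finset.mul_sum]
    exact Finset.sum_le_sum fun i _ => hA0lo _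
  have h0hi : ∀ v, v ⬝ᵥ ((1 : Matrix (Fin Q) (Fin Q) ℝ) ⊗ₖ A0) *ᵥ v ≤ νhi * (v ⬝ᵥ K *ᵥ v) := by
    intro v
    rw [hK, aux_one_kron, aux_one_kron, Finset.mul_sum]
    exact Finset.sum_le_sum fun i _ => hA0hi _
  have hα : 0 < νlo - √3 * σ * χ := by linarith
  have hβ : 0 < νhi + √3 * σ * χ := by
    have : 0 ≤ χ := hχ ▸ Finset.sum_nonneg fun m _ => hχm m
    have : 0 ≤ √3 * σ * χ := by positivity
    linarith
  have hlow : ∀ v, (νlo - √3 * σ * χ) * (v ⬝ᵥ K *ᵥ v) ≤ v ⬝ᵥ 𝒜 *ᵥ v := by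
    intro v
    rw [hexp]
    linarith [h0lo v, hlb v]
  have hupp : ∀ v, v ⬝ᵥ 𝒜 *ᵥ v ≤ (νhi + √3 * σ * χ) * (v ⬝ᵥ K *ᵥ v) := by
    intro v
    rw [hexp]
    linarith [h0hi v, hub v]
  have hKu := aux_unit K hKp
  have h𝒜u := aux_unit 𝒜 fun v hv => lt_of_lt_of_le (mul_pos hα (hKp v hv)) (hlow v)
  have key : ∀ X : Matrix (Fin Q × Fin Nu) (Fin Q × Fin Nu) ℝ,
      p ⬝ᵥ (((1 : Matrix (Fin Q) (Fin Q) ℝ) ⊗ₖ B) * X *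
            ((1 : Matrix (Fin Q) (Fin Q) ℝ) ⊗ₖ B)ᵀ) *ᵥ p =
      (((1 : Matrix (Fin Q) (Fin Q) ℝ) ⊗ₖ B)ᵀ *ᵥ p) ⬝ᵥ X *ᵥ
        (((1 : Matrix (Fin Q) (Fin Q) ℝ) ⊗ₖ B)ᵀ *ᵥ p) := by
    intro X
    rw [← mulVec_mulVec, ← mulVec_mulVec, dotProduct_mulVec, ← mulVec_transpose]
  have hKS : p ⬝ᵥ (((1 : Matrix (Fin Q) (Fin Q) ℝ) ⊗ₖ B) * K⁻¹ *
            ((1 : Matrix (Fin Q) (Fin Q) ℝ) ⊗ₖ B)ᵀ) *ᵥ p =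
      p ⬝ᵥ ((1 : Matrix (Fin Q) (Fin Q) ℝ) ⊗ₖ (B * A⁻¹ * Bᵀ)) *ᵥ p := by
    rw [hK, inv_kronecker, inv_one, ← kroneckerMap_transpose, ← mul_kronecker_mul,
      ← mul_kronecker_mul, transpose_one, one_mul, one_mul]
  have hS1 : θ ^ 2 * γ ^ 2 * (p ⬝ᵥ ((1 : Matrix (Fin Q) (Fin Q) ℝ) ⊗ₖ Dp) *ᵥ p) ≤
      p ⬝ᵥ ((1 : Matrix (Fin Q) (Fin Q) ℝ) ⊗ₖ (B * A⁻¹ * Bᵀ)) *ᵥ p := by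
    rw [aux_one_kron, aux_one_kron, Finset.mul_sum]
    exact Finset.sum_le_sum fun i _ => hSlo _
  have hS2 : p ⬝ᵥ ((1 : Matrix (Fin Q) (Fin Q) ℝ) ⊗ₖ (B * A⁻¹ * Bᵀ)) *ᵥ p ≤
      Θ ^ 2 * (p ⬝ᵥ ((1 : Matrix (Fin Q) (Fin Q) ℝ) ⊗ₖ Dp) *ᵥ p) := by
    rw [aux_one_kron, aux_one_kron, Finset.mul_sum]
    exact Finset.sum_le_sum fun i _ => hShi _
  rw [← hKS, key] at hS1 hS2
  rw [key]
  constructor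
  · have := aux_inv_mono 𝒜 K (νhi + √3 * σ * χ)⁻¹ (inv_pos.mpr hβ) h𝒜s
      (fun v => (mul_nonneg hα.le (hKp' v)).trans (hlow v)) h𝒜u hKu
      (fun v => by rw [inv_mul_le_iff₀ hβ]; exact hupp v)
      (((1 : Matrix (Fin Q) (Fin Q) ℝ) ⊗ₖ B)ᵀ *ᵥ p)
    rw [inv_mul_le_iff₀ hβ] at this
    rw [div_mul_eq_mul_div, div_le_iff₀ hβ]
    linarith
  · have := aux_inv_mono K 𝒜 (νlo - √3 * σ * χ) hα hKs hKp' hKu h𝒜u hlow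
      (((1 : Matrix (Fin Q) (Fin Q) ℝ) ⊗ₖ B)ᵀ *ᵥ p)
    rw [div_mul_eq_mul_div, le_div_iff₀ hα]
    linarith
end

section
/- Let 𝒜 and Ã be real symmetric n×n matrices, 𝒮̃ a real symmetric m×m matrix, ℬ a real m×n matrix, and a ∈ ℝ, such that a·Ã and 𝒮̃ are invertible. Define the saddle point matrix C := [[𝒜, ℬ^T], [ℬ, 0]], the block triangular preconditioner P₂ := [[a·Ã, 0], [ℬ, −𝒮̃]], and H := [[𝒜 − a·Ã, 0], [0, 𝒮̃]]. Then P₂ is invertible and the preconditioned matrix P₂^{-1} C is H-symmetric: H·(P₂^{-1} C) = (P₂^{-1} C)^T·H. -/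
open Matrix

/-- The block triangular preconditioned saddle point matrix `P₂⁻¹ C` is
`H`-symmetric. -/
theorem stmt_7
    (n m : ℕ)
    (𝒜 Atil : Matrix (Fin n) (Fin n) ℝ)
    (h𝒜symm : 𝒜.IsSymm) (hAtilsymm : Atil.IsSymm)
    (Stil : Matrix (Fin m) (Fin m) ℝ) (hStilsymm : Stil.IsSymm)
    (B : Matrix (Fin m) (Fin n) ℝ)
    (a : ℝ)
    (haAtil : IsUnit (a • Atil)) (hStil : IsUnit Stil)
    (C P₂ H : Matrix (Fin n ⊕ Fin m) (Fin n ⊕ Fin m) ℝ)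
    (hC : C = Matrix.fromBlocks 𝒜 Bᵀ B 0)
    (hP₂ : P₂ = Matrix.fromBlocks (a • Atil) 0 B (-Stil))
    (hH : H = Matrix.fromBlocks (𝒜 - a • Atil) 0 0 Stil) :
    IsUnit P₂ ∧ H * (P₂⁻¹ * C) = (P₂⁻¹ * C)ᵀ * H := by
  have hMs : (a • Atil).IsSymm := by
    unfold Matrix.IsSymm
    rw [Matrix.transpose_smul, hAtilsymm.eq]
  generalize a • Atil = M at *
  have hP : IsUnit P₂ := by
    rw [hP₂]
    exact Matrix.isUnit_fromBlocks_zero₁₂.2 ⟨haAtil, hStil.neg⟩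
  refine ⟨hP, ?_⟩
  have hM1 : M * M⁻¹ = 1 :=
    Matrix.mul_nonsing_inv _ ((Matrix.isUnit_iff_isUnit_det _).1 haAtil)
  have hM2 : M⁻¹ * M = 1 :=
    Matrix.nonsing_inv_mul _ ((Matrix.isUnit_iff_isUnit_det _).1 haAtil)
  have hS1 : Stil * Stil⁻¹ = 1 :=
    Matrix.mul_nonsing_inv _ ((Matrix.isUnit_iff_isUnit_det _).1 hStil)
  have hP2 : P₂⁻¹ * P₂ = 1 :=
    Matrix.nonsing_inv_mul _ ((Matrix.isUnit_iff_isUnit_det _).1 hP)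
  have hNs : (M⁻¹)ᵀ = M⁻¹ := by rw [Matrix.transpose_nonsing_inv, hMs.eq]
  have hK : P₂⁻¹ * C = Matrix.fromBlocks (M⁻¹ * 𝒜) (M⁻¹ * Bᵀ)
      (Stil⁻¹ * (B * (M⁻¹ * 𝒜) - B)) (Stil⁻¹ * (B * (M⁻¹ * Bᵀ))) := by
    have hc : C = P₂ * Matrix.fromBlocks (M⁻¹ * 𝒜) (M⁻¹ * Bᵀ)
      (Stil⁻¹ * (B * (M⁻¹ * 𝒜) - B)) (Stil⁻¹ * (B * (M⁻¹ * Bᵀ))) := by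
      rw [hC, hP₂, Matrix.fromBlocks_multiply]
      simp only [Matrix.neg_mul, ← Matrix.mul_assoc, hM1, hS1, Matrix.one_mul, Matrix.zero_mul]
      congr 1 <;> abel
    rw [hc, ← Matrix.mul_assoc, hP2, Matrix.one_mul]
  have hHs : Hᵀ = H := by
    rw [hH, Matrix.fromBlocks_transpose, Matrix.transpose_sub, h𝒜symm.eq, hMs.eq, hStilsymm.eq]
    simp
  have hG : H * (P₂⁻¹ * C) = Matrix.fromBlocks (𝒜 * M⁻¹ * 𝒜 - 𝒜) (𝒜 * M⁻¹ * Bᵀ - Bᵀ)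
      (B * M⁻¹ * 𝒜 - B) (B * M⁻¹ * Bᵀ) := by
    rw [hK, hH, Matrix.fromBlocks_multiply]
    simp only [Matrix.sub_mul, ← Matrix.mul_assoc, hM1, hS1, Matrix.one_mul, Matrix.zero_mul,
      add_zero, zero_add]
  have hT : (H * (P₂⁻¹ * C))ᵀ = H * (P₂⁻¹ * C) := by
    rw [hG, Matrix.fromBlocks_transpose]
    simp only [Matrix.transpose_sub, Matrix.transpose_mul, Matrix.transpose_transpose, hNs,
      h𝒜symm.eq, Matrix.mul_assoc]
  rw [← hT, Matrix.transpose_mul, hHs]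
end

section
/- Let 𝒜 and Ã be real symmetric positive definite n×n matrices, 𝒮̃ a real symmetric positive definite m×m matrix, ℬ a real m×n matrix whose transpose ℬ^T is injective (ℬ^T p = 0 implies p = 0), and a > 0 such that 𝒜 − a·Ã is positive definite. Define C := [[𝒜, ℬ^T], [ℬ, 0]], P₂ := [[a·Ã, 0], [ℬ, −𝒮̃]], and H := [[𝒜 − a·Ã, 0], [0, 𝒮̃]]. Then P₂ is invertible and P₂^{-1} C is H-positive definite: w^T H P₂^{-1} C w > 0 for every w ∈ ℝ^{n+m} with w ≠ 0. -/
open Matrix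

/-- The block triangular preconditioned saddle point matrix `P₂⁻¹ C` is
`H`-positive definite. -/
theorem stmt_8
    (n m : ℕ)
    (𝒜 Atil : Matrix (Fin n) (Fin n) ℝ)
    (h𝒜symm : 𝒜.IsSymm) (hAtilsymm : Atil.IsSymm)
    (h𝒜pd : ∀ v : Fin n → ℝ, v ≠ 0 → 0 < v ⬝ᵥ 𝒜 *ᵥ v)
    (hAtilpd : ∀ v : Fin n → ℝ, v ≠ 0 → 0 < v ⬝ᵥ Atil *ᵥ v)
    (Stil : Matrix (Fin m) (Fin m) ℝ) (hStilsymm : Stil.IsSymm)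
    (hStilpd : ∀ q : Fin m → ℝ, q ≠ 0 → 0 < q ⬝ᵥ Stil *ᵥ q)
    (B : Matrix (Fin m) (Fin n) ℝ)
    (hBT : ∀ p : Fin m → ℝ, Bᵀ *ᵥ p = 0 → p = 0)
    (a : ℝ) (ha : 0 < a)
    (hdiff : ∀ v : Fin n → ℝ, v ≠ 0 → 0 < v ⬝ᵥ (𝒜 - a • Atil) *ᵥ v)
    (C P₂ H : Matrix (Fin n ⊕ Fin m) (Fin n ⊕ Fin m) ℝ)
    (hC : C = Matrix.fromBlocks 𝒜 Bᵀ B 0)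
    (hP₂ : P₂ = Matrix.fromBlocks (a • Atil) 0 B (-Stil))
    (hH : H = Matrix.fromBlocks (𝒜 - a • Atil) 0 0 Stil) :
    IsUnit P₂ ∧
    ∀ w : Fin n ⊕ Fin m → ℝ, w ≠ 0 → 0 < w ⬝ᵥ (H * P₂⁻¹ * C) *ᵥ w := by
  have hU : IsUnit P₂ := by
    rw [← Matrix.mulVec_injective_iff_isUnit]
    rw [← Matrix.coe_mulVecLin, injective_iff_map_eq_zero]
    intro z hz
    rw [Matrix.mulVecLin_apply] at hz
    obtain ⟨x, y, rfl⟩ : ∃ x y, z = Sum.elim x y :=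
      ⟨z ∘ Sum.inl, z ∘ Sum.inr, (Sum.elim_comp_inl_inr z).symm⟩
    rw [hP₂, Matrix.fromBlocks_mulVec] at hz
    have h1 := congrArg (fun f => f ∘ Sum.inl) hz
    have h2 := congrArg (fun f => f ∘ Sum.inr) hz
    simp only [Sum.elim_comp_inl, Sum.elim_comp_inr] at h1 h2
    have hx : x = 0 := by
      by_contra hx
      have h := hAtilpd x hx
      have h3 := congrArg (fun f => x ⬝ᵥ f) h1
      simp [Matrix.smul_mulVec] at h3
      rcases h3 with h3 | h3
      · exact ha.ne' h3
      · exact h.ne' h3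
    have hy : y = 0 := by
      by_contra hy
      have h := hStilpd y hy
      have h3 : B *ᵥ x + (-Stil) *ᵥ y = 0 := h2
      rw [hx, mulVec_zero, zero_add, neg_mulVec, neg_eq_zero] at h3
      rw [h3, dotProduct_zero] at h
      exact lt_irrefl _ h
    subst hx hy
    ext i
    cases i <;> rfl
  refine ⟨hU, ?_⟩
  intro w hw
  obtain ⟨z, hz⟩ : ∃ z, z = P₂⁻¹ *ᵥ (C *ᵥ w) := ⟨_, rfl⟩
  have hPz : P₂ *ᵥ z = C *ᵥ w := by
    rw [hz, mulVec_mulVec, Matrix.mul_nonsing_inv _ ((Matrix.isUnit_iff_isUnit_det _).1 hU),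
      one_mulVec]
  rw [← mulVec_mulVec, ← mulVec_mulVec, ← hz]
  clear hz
  obtain ⟨x, y, rfl⟩ : ∃ x y, z = Sum.elim x y :=
    ⟨z ∘ Sum.inl, z ∘ Sum.inr, (Sum.elim_comp_inl_inr z).symm⟩
  obtain ⟨u, p, rfl⟩ : ∃ x y, w = Sum.elim x y :=
    ⟨w ∘ Sum.inl, w ∘ Sum.inr, (Sum.elim_comp_inl_inr w).symm⟩
  rw [hP₂, hC, Matrix.fromBlocks_mulVec, Matrix.fromBlocks_mulVec] at hPz
  have h1 := congrArg (fun f => f ∘ Sum.inl) hPz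
  have h2 := congrArg (fun f => f ∘ Sum.inr) hPz
  simp only [Sum.elim_comp_inl, Sum.elim_comp_inr, zero_mulVec, add_zero, neg_mulVec] at h1 h2
  have hSy : Stil *ᵥ y = B *ᵥ x - B *ᵥ u := by rw [← h2]; abel
  have hBp : Bᵀ *ᵥ p = (a • Atil) *ᵥ x - 𝒜 *ᵥ u := by rw [h1]; abel
  rw [hH, Matrix.fromBlocks_mulVec, sumElim_dotProduct_sumElim]
  simp only [Sum.elim_comp_inl, Sum.elim_comp_inr, zero_mulVec, add_zero, zero_add]
  have hB : ∀ v, p ⬝ᵥ B *ᵥ v = ((a • Atil) *ᵥ x - 𝒜 *ᵥ u) ⬝ᵥ v := by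
    intro v
    rw [← hBp, dotProduct_mulVec, mulVec_transpose]
  have hsy : ∀ M : Matrix (Fin n) (Fin n) ℝ, M.IsSymm → ∀ v w, (M *ᵥ v) ⬝ᵥ w = v ⬝ᵥ M *ᵥ w := by
    intro M hM v w
    rw [dotProduct_mulVec, ← mulVec_transpose, hM.eq]
  have hE : (a • Atil).IsSymm := hAtilsymm.smul a
  have hc : u ⬝ᵥ (a • Atil) *ᵥ x = x ⬝ᵥ (a • Atil) *ᵥ u := by
    rw [← hsy _ hE, dotProduct_comm]
  have key : u ⬝ᵥ (𝒜 - a • Atil) *ᵥ x + p ⬝ᵥ Stil *ᵥ y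
      = a * ((x - u) ⬝ᵥ Atil *ᵥ (x - u)) + u ⬝ᵥ (𝒜 - a • Atil) *ᵥ u := by
    have e : a * ((x - u) ⬝ᵥ Atil *ᵥ (x - u)) = (x - u) ⬝ᵥ (a • Atil) *ᵥ (x - u) := by
      rw [smul_mulVec, dotProduct_smul, smul_eq_mul]
    rw [e, hSy, dotProduct_sub, hB, hB]
    simp only [sub_mulVec, mulVec_sub, dotProduct_sub, sub_dotProduct, hsy _ hE, hsy _ h𝒜symm]
    linarith
  rw [key]
  have hn : 0 ≤ a * ((x - u) ⬝ᵥ Atil *ᵥ (x - u)) := by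
    by_cases h : x - u = 0
    · simp [h]
    · exact (mul_pos ha (hAtilpd _ h)).le
  by_cases hu : u = 0
  · subst hu
    have hp : p ≠ 0 := by
      rintro rfl
      apply hw
      ext i
      cases i <;> rfl
    have hx : x ≠ 0 := by
      rintro rfl
      apply hp
      apply hBT
      rw [hBp]; simp
    have := mul_pos ha (hAtilpd x hx)
    simpa using this
  · have := hdiff u hu
    linarith
end
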